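/- Let Q be a coherent multiplicative lattice: a commutative monoid with a complete lattice structure satisfying a * sSup S = ⨆_{s ∈ S} (a * s), in which every element is the supremum of the compact elements below it, the product of two compact elements is compact, and the identity element 1 is compact. Define x / y := sSup {z | z * y ≤ x}. Let ⋆ be a finitary nucleus on Q and define ⋆̄(x) = ⨆ { x / z | z ≤ 1 and ⋆(z) = ⋆(1) }. Then ⋆̄(x) = ⨆ { x / z | z compact, z ≤ 1, and ⋆(z) = ⋆(1) } for every x, and ⋆̄ is finitary. -/

import Mathlib

open CompleteLattice

/-- A closure operation on a poset: expansive, monotone, idempotent. -/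
def IsClosureOp {S : Type*} [Preorder S] (star : S → S) : Prop :=
  (∀ x, x ≤ star x) ∧ (∀ x y, x ≤ y → star x ≤ star y) ∧ (∀ x, star (star x) = star x)

/-- A nucleus on an ordered magma: a closure operation `star` with
`star x * star y ≤ star (x * y)`. -/
def IsNucleusOp {M : Type*} [Preorder M] [Mul M] (star : M → M) : Prop :=
  IsClosureOp star ∧ ∀ x y, star x * star y ≤ star (x * y)

/-- A closure operation is finitary if it commutes with suprema of nonempty
directed sets. -/
def FinitaryOp {S : Type*} [CompleteLattice S] (star : S → S) : Prop :=
  ∀ Δ : Set S, Δ.Nonempty → DirectedOn (· ≤ ·) Δ → star (sSup Δ) = ⨆ d ∈ Δ, star d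

/-- Below a given element, compact elements are closed under binary joins. -/
theorem directedOn_isCompactElement_le {Q : Type*} [CompleteLattice Q] (x : Q) :
    DirectedOn (· ≤ ·) {c : Q | IsCompactElement c ∧ c ≤ x} := by
  rintro a ⟨ha, hax⟩ b ⟨hb, hbx⟩
  refine ⟨a ⊔ b, ⟨fun s u hs hd hu h => ?_, sup_le hax hbx⟩, le_sup_left, le_sup_right⟩
  obtain ⟨p, hp, hap⟩ := ha s u hs hd hu (le_sup_left.trans h)
  obtain ⟨q, hq, hbq⟩ := hb s u hs hd hu (le_sup_right.trans h)
  obtain ⟨r, hr, hpr, hqr⟩ := hd p hp q hq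
  exact ⟨r, hr, sup_le (hap.trans hpr) (hbq.trans hqr)⟩

theorem IsCompactElement.exists_le_of_le_sSup {Q : Type*} [CompleteLattice Q] {c : Q}
    (hc : IsCompactElement c) {s : Set Q} (hs : s.Nonempty) (hd : DirectedOn (· ≤ ·) s)
    (h : c ≤ sSup s) : ∃ d ∈ s, c ≤ d :=
  hc s _ hs hd (_root_.isLUB_sSup s) h

/-- If a finitary closure operation identifies `z` with a compact element `e` above it, it already
identifies `e` with some compact element below `z`. -/
theorem FinitaryOp.exists_isCompactElement_le {Q : Type*} [CompleteLattice Q] {star : Q → Q}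
    (hfin : FinitaryOp star) (hstar : IsClosureOp star)
    (halg : ∀ x : Q, x = sSup {c | IsCompactElement c ∧ c ≤ x})
    {e z : Q} (he : IsCompactElement e) (hz : z ≤ e) (h : star z = star e) :
    ∃ c, IsCompactElement c ∧ c ≤ z ∧ star c = star e := by
  obtain ⟨hexp, hmono, hidem⟩ := hstar
  have hd := directedOn_isCompactElement_le z
  have hne : {c : Q | IsCompactElement c ∧ c ≤ z}.Nonempty :=
    ⟨⊥, fun s _ hs _ _ _ => hs.imp fun _ ha => ⟨ha, bot_le⟩, bot_le⟩
  have hle : e ≤ sSup (star '' {c | IsCompactElement c ∧ c ≤ z}) := by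
    rw [sSup_image, ← hfin _ hne hd, ← halg z, h]
    exact hexp e
  have hd' : DirectedOn (· ≤ ·) (star '' {c | IsCompactElement c ∧ c ≤ z}) := by
    rintro _ ⟨a, ha, rfl⟩ _ ⟨b, hb, rfl⟩
    obtain ⟨c, hc, hac, hbc⟩ := hd a ha b hb
    exact ⟨_, ⟨c, hc, rfl⟩, hmono _ _ hac, hmono _ _ hbc⟩
  obtain ⟨_, ⟨c, ⟨hc, hcz⟩, rfl⟩, hec⟩ := he.exists_le_of_le_sSup (hne.image star) hd' hle
  refine ⟨c, hc, hcz, le_antisymm (hmono _ _ (hcz.trans hz)) ?_⟩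
  simpa only [hidem] using hmono _ _ hec

theorem stmt17 (Q : Type*) [CommMonoid Q] [CompleteLattice Q]
    (hl : ∀ (a : Q) (S : Set Q), a * sSup S = ⨆ s ∈ S, a * s)
    (halg : ∀ x : Q, x = sSup {c | IsCompactElement c ∧ c ≤ x})
    (hcomp : ∀ x y : Q, IsCompactElement x → IsCompactElement y →
      IsCompactElement (x * y))
    (h1 : IsCompactElement (1 : Q))
    (div : Q → Q → Q) (hdiv : ∀ x y, div x y = sSup {z | z * y ≤ x})
    (star : Q → Q) (hstar : IsNucleusOp star) (hfin : FinitaryOp star)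
    (bar : Q → Q)
    (hbar : ∀ x, bar x = sSup (div x '' {z | z ≤ 1 ∧ star z = star 1})) :
    (∀ x, bar x =
        sSup (div x '' {z | IsCompactElement z ∧ z ≤ 1 ∧ star z = star 1})) ∧
      FinitaryOp bar := by
  have hmul (a b c : Q) (h : b ≤ c) : a * b ≤ a * c := by
    have hs := hl a {b, c}
    rw [sSup_pair, sup_eq_right.mpr h] at hs
    rw [hs]
    exact le_iSup₂_of_le b (Set.mem_insert b {c}) le_rfl
  have hle_div {w x z : Q} (h : w * z ≤ x) : w ≤ div x z := by
    rw [hdiv]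
    exact le_sSup h
  have hdiv_mul (x z : Q) : div x z * z ≤ x := by
    rw [hdiv, mul_comm, hl]
    exact iSup₂_le fun w hw => (mul_comm z w).trans_le hw
  have hcompact (x : Q) : bar x =
      sSup (div x '' {z | IsCompactElement z ∧ z ≤ 1 ∧ star z = star 1}) := by
    rw [hbar]
    refine le_antisymm (sSup_le ?_) (sSup_le_sSup (Set.image_mono fun z hz => hz.2))
    rintro _ ⟨z, ⟨hz1, hz⟩, rfl⟩
    obtain ⟨c, hc, hcz, hc1⟩ := hfin.exists_isCompactElement_le hstar.1 halg h1 hz1 hz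
    exact (hle_div ((hmul _ _ _ hcz).trans (hdiv_mul x z))).trans
      (le_sSup ⟨c, ⟨hc, hcz.trans hz1, hc1⟩, rfl⟩)
  refine ⟨hcompact, fun Δ hne hd => le_antisymm ?_ (iSup₂_le fun d hdΔ => ?_)⟩
  · rw [hcompact]
    refine sSup_le ?_
    rintro _ ⟨z, ⟨hzc, hz⟩, rfl⟩
    rw [halg (div (sSup Δ) z)]
    refine sSup_le fun c ⟨hc, hcz⟩ => ?_
    have hcz' : c * z ≤ sSup Δ := by
      rw [mul_comm]
      refine (hmul _ _ _ hcz).trans ?_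
      rw [mul_comm]
      exact hdiv_mul _ z
    obtain ⟨d, hdΔ, hcd⟩ := (hcomp c z hc hzc).exists_le_of_le_sSup hne hd hcz'
    refine le_iSup₂_of_le d hdΔ ?_
    rw [hbar]
    exact (hle_div hcd).trans (le_sSup ⟨z, hz, rfl⟩)
  · rw [hbar, hbar]
    refine sSup_le ?_
    rintro _ ⟨z, hz, rfl⟩
    exact (hle_div ((hdiv_mul d z).trans (le_sSup hdΔ))).trans (le_sSup ⟨z, hz, rfl⟩)
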